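/- Let D ⊊ C ⊆ {0,1}^n be extremal concept classes satisfying the cubical colour condition. Then every maximal cube c of C not contained in D, with colour set I, contains a unique vertex v(c) whose projection p_I(v(c)) does not belong to p_I(D), and the assignment c ↦ v(c) is a bijection from the set of maximal cubes of C not contained in D onto C ∖ D. -/

import Mathlib

variable {n : ℕ}

/-- Coordinatewise intersection (Boolean product) of two vertices. -/
def interV {α : Type*} (v w : α → Bool) : α → Bool := fun i => v i && w i

/-- A class is intersection closed if it is closed under coordinatewise products. -/
def IntersectionClosed {α : Type*} (C : Set (α → Bool)) : Prop :=
  ∀ v ∈ C, ∀ w ∈ C, interV v w ∈ C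

/-- The intersection closure: all iterated intersections of nonempty finite subsets. -/
def interClosure {α : Type*} (C : Set (α → Bool)) : Set (α → Bool) :=
  {x | ∃ S : Finset (α → Bool), S.Nonempty ∧ ↑S ⊆ C ∧ x = fun i => S.inf fun u => u i}

/-- Coordinate projection to the coordinates in `J`. -/
def proj (J : Finset (Fin n)) (v : Fin n → Bool) : {i // i ∈ J} → Bool := fun j => v j.1

/-- `C` shatters `I` if the projection of `C` to `I` is the full cube. -/
def Shatters (C : Set (Fin n → Bool)) (I : Finset (Fin n)) : Prop :=
  proj I '' C = Set.univ

/-- The VC dimension: the largest cardinality of a shattered set of coordinates. -/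
noncomputable def VCdim (C : Set (Fin n → Bool)) : ℕ :=
  sSup {k | ∃ I : Finset (Fin n), I.card = k ∧ Shatters C I}

/-- A shortest path in `A` from `u` to `v`: a sequence of length `hammingDist u v`
starting at `u`, ending at `v`, with all vertices in `A` and consecutive vertices
at Hamming distance `1`. -/
def IsShortestPath (A : Set (Fin n → Bool)) (u v : Fin n → Bool)
    (seq : Fin (hammingDist u v + 1) → Fin n → Bool) : Prop :=
  seq 0 = u ∧ seq (Fin.last (hammingDist u v)) = v ∧ (∀ i, seq i ∈ A) ∧
    ∀ i : Fin (hammingDist u v), hammingDist (seq i.castSucc) (seq i.succ) = 1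

/-- A class is shortest-path closed if any two of its vertices are joined by a
shortest path inside the class. -/
def SPClosed (C : Set (Fin n → Bool)) : Prop :=
  ∀ u ∈ C, ∀ v ∈ C, ∃ seq, IsShortestPath C u v seq

/-- A cube with colour set `I` (and some anchor `a` outside `I`). -/
def IsCubeOn (I : Finset (Fin n)) (c : Set (Fin n → Bool)) : Prop :=
  ∃ a : Fin n → Bool, c = {v | ∀ i, i ∉ I → v i = a i}

/-- A cube (with some colour set). -/
def IsCube (c : Set (Fin n → Bool)) : Prop := ∃ I, IsCubeOn I c

/-- `c` is a maximal cube of `A`: a cube contained in `A` not properly contained in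
another cube contained in `A`. -/
def MaximalCubeIn (A c : Set (Fin n → Bool)) : Prop :=
  IsCube c ∧ c ⊆ A ∧ ∀ c', IsCube c' → c' ⊆ A → c ⊆ c' → c' = c

/-- A class is extremal if every shattered colour set is witnessed by a cube inside
the class. -/
def Extremal (C : Set (Fin n → Bool)) : Prop :=
  ∀ I : Finset (Fin n), Shatters C I → ∃ c, IsCubeOn I c ∧ c ⊆ C

/-- The cubical colour condition for the pair `(C, D)`: every cube contained in `C`
that is not maximal in `C` has a cube in `D` with the same colour set. -/
def CCC (C D : Set (Fin n → Bool)) : Prop :=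
  ∀ I c, IsCubeOn I c → c ⊆ C → ¬ MaximalCubeIn C c →
    ∃ c', IsCubeOn I c' ∧ c' ⊆ D

/-- `A` has an edge of colour `i`: two vertices of `A` differing exactly at `i`. -/
def HasEdge (A : Set (Fin n → Bool)) (i : Fin n) : Prop :=
  ∃ v ∈ A, ∃ w ∈ A, v i ≠ w i ∧ ∀ j, j ≠ i → v j = w j

/-- An unlabelled compression scheme of size `k` for `C`. -/
def HasCompression (C : Set (Fin n → Bool)) (k : ℕ) : Prop :=
  ∃ r : (Fin n → Bool) → Finset (Fin n),
    Set.InjOn r C ∧ (∀ v ∈ C, (r v).card ≤ k) ∧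
      ∀ v ∈ C, ∀ w ∈ C, v ≠ w → ∃ i ∈ r v ∪ r w, v i ≠ w i

/-- Coordinates where `v` is `1` but `w` is `0`. -/
def delta (v w : Fin n → Bool) : Finset (Fin n) :=
  Finset.univ.filter fun i => v i = true ∧ w i = false

/-- The vertex obtained from `v` by setting to `0` the `j` smallest (in the order
induced by the permutation `π`) coordinates of `delta v w`. -/
def stepVert (π : Equiv.Perm (Fin n)) (v w : Fin n → Bool) (j : ℕ) : Fin n → Bool :=
  fun i =>
    if i ∈ delta v w ∧ ((delta v w).filter fun i' => π i' < π i).card < j then false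
    else v i

/-- The shortest-path closure construction of `C` (with respect to the linear order
on coordinates induced by `π`). -/
def spClosure (π : Equiv.Perm (Fin n)) (C : Set (Fin n → Bool)) : Set (Fin n → Bool) :=
  {x | ∃ v ∈ C, ∃ w ∈ C, w ≤ v ∧ ∃ j ≤ (delta v w).card, x = stepVert π v w j}

/-- Coordinatewise XOR with `b` (a change of origin). -/
def xorShift (b : Fin n → Bool) (C : Set (Fin n → Bool)) : Set (Fin n → Bool) :=
  (fun v i => xor (v i) (b i)) '' C

/-- The `k`-close cube condition. -/
def KCloseCube (C : Set (Fin n → Bool)) (k : ℕ) : Prop :=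
  ∃ v : Fin n → Bool, ∀ J : Finset (Fin n), J.card = k + 1 →
    ∃ b : {i // i ∈ J} → Bool, hammingDist b (proj J v) ≤ 1 ∧ b ∉ proj J '' C

/-- The vertices of the cube with colour set `I` through `v`. -/
def cubeAt (I : Finset (Fin n)) (v : Fin n → Bool) : Finset (Fin n → Bool) :=
  {x | ∀ i, i ∉ I → x i = v i}

/-- The parity sign of the number of coordinates of `I` where `x` differs from `v`. -/
def cubeSign (I : Finset (Fin n)) (v x : Fin n → Bool) : ℤ :=
  ∏ i ∈ I, if x i = v i then 1 else -1

/-- The indicator function of the vertices agreeing with `v` on `I`. -/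
def agreeInd (I : Finset (Fin n)) (v x : Fin n → Bool) : ℤ :=
  ∏ i ∈ I, if x i = v i then 1 else 0

/-- The alternating sum of `h` over the cube with colour set `I` through `v`. -/
def altSum (I : Finset (Fin n)) (v : Fin n → Bool) (h : (Fin n → Bool) → ℤ) : ℤ :=
  ∑ x ∈ cubeAt I v, cubeSign I v x * h x

theorem mem_cubeAt {I : Finset (Fin n)} {v x : Fin n → Bool} :
    x ∈ cubeAt I v ↔ ∀ i, i ∉ I → x i = v i := by
  simp [cubeAt]

theorem self_mem_cubeAt (I : Finset (Fin n)) (v : Fin n → Bool) : v ∈ cubeAt I v :=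
  mem_cubeAt.2 fun _ _ => rfl

theorem cubeAt_mono {I J : Finset (Fin n)} (h : I ⊆ J) (v : Fin n → Bool) :
    cubeAt I v ⊆ cubeAt J v := fun _ hx =>
  mem_cubeAt.2 fun i hi => mem_cubeAt.1 hx i fun h' => hi (h h')

theorem cubeAt_eq_of_mem {I : Finset (Fin n)} {v x : Fin n → Bool} (h : x ∈ cubeAt I v) :
    cubeAt I x = cubeAt I v := by
  ext y
  simp only [mem_cubeAt] at *
  exact forall₂_congr fun i hi => by rw [h i hi]

theorem isCubeOn_cubeAt (I : Finset (Fin n)) (v : Fin n → Bool) :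
    IsCubeOn I (cubeAt I v : Set (Fin n → Bool)) :=
  ⟨v, by ext; simp [mem_cubeAt]⟩

theorem IsCubeOn.exists_eq_cubeAt {I : Finset (Fin n)} {c : Set (Fin n → Bool)}
    (h : IsCubeOn I c) : ∃ v, c = cubeAt I v := by
  obtain ⟨a, rfl⟩ := h
  exact ⟨a, by ext; simp [mem_cubeAt]⟩

theorem proj_eq_proj_iff {I : Finset (Fin n)} {v w : Fin n → Bool} :
    proj I v = proj I w ↔ ∀ i ∈ I, v i = w i := by
  simp [proj, funext_iff]

theorem exists_mem_cubeAt_agree (I : Finset (Fin n)) (v u : Fin n → Bool) :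
    ∃ x ∈ cubeAt I v, ∀ i ∈ I, x i = u i := by
  classical
  refine ⟨fun i => if i ∈ I then u i else v i, mem_cubeAt.2 fun i hi => by simp [hi], ?_⟩
  intro i hi
  simp [hi]

theorem eq_of_mem_cubeAt {I : Finset (Fin n)} {v x y : Fin n → Bool} (hx : x ∈ cubeAt I v)
    (hy : y ∈ cubeAt I v) (h : ∀ i ∈ I, x i = y i) : x = y := by
  funext i
  by_cases hi : i ∈ I
  · exact h i hi
  · rw [mem_cubeAt.1 hx i hi, mem_cubeAt.1 hy i hi]

theorem shatters_iff {C : Set (Fin n → Bool)} {I : Finset (Fin n)} :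
    Shatters C I ↔ ∀ u : Fin n → Bool, ∃ x ∈ C, ∀ i ∈ I, x i = u i := by
  classical
  rw [Shatters, Set.eq_univ_iff_forall]
  constructor
  · intro h u
    obtain ⟨x, hx, hxu⟩ := h (proj I u)
    exact ⟨x, hx, proj_eq_proj_iff.1 hxu⟩
  · intro h b
    obtain ⟨x, hx, hxu⟩ := h fun i => if hi : i ∈ I then b ⟨i, hi⟩ else false
    refine ⟨x, hx, funext fun j => ?_⟩
    simp [proj, hxu j.1 j.2]

theorem shatters_of_cubeAt_subset {C : Set (Fin n → Bool)} {I : Finset (Fin n)}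
    {v : Fin n → Bool} (h : (cubeAt I v : Set (Fin n → Bool)) ⊆ C) : Shatters C I :=
  shatters_iff.2 fun u =>
    let ⟨x, hx, hxu⟩ := exists_mem_cubeAt_agree I v u
    ⟨x, h hx, hxu⟩

theorem colours_subset_of_cubeAt_subset {I J : Finset (Fin n)} {v w : Fin n → Bool}
    (h : cubeAt I v ⊆ cubeAt J w) : I ⊆ J := by
  classical
  intro i hi
  by_contra hj
  obtain ⟨x, hx, hxu⟩ := exists_mem_cubeAt_agree I v fun k => !w k
  have h1 := mem_cubeAt.1 (h hx) i hj
  rw [hxu i hi] at h1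
  simp at h1

theorem agreeInd_eq_ite (I : Finset (Fin n)) (v x : Fin n → Bool) :
    agreeInd I v x = if ∀ i ∈ I, x i = v i then 1 else 0 := by
  simp [agreeInd, Finset.prod_ite_zero]

theorem cubeSign_of_agree {I : Finset (Fin n)} {v x : Fin n → Bool} (h : ∀ i ∈ I, x i = v i) :
    cubeSign I v x = 1 :=
  Finset.prod_eq_one fun i hi => by simp [h i hi]

theorem cubeSign_ne_zero (I : Finset (Fin n)) (v x : Fin n → Bool) : cubeSign I v x ≠ 0 :=
  Finset.prod_ne_zero_iff.2 fun i _ => by split_ifs <;> simp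

theorem cubeSign_update {I : Finset (Fin n)} {j : Fin n} (hj : j ∈ I) (v x : Fin n → Bool) :
    cubeSign I v (Function.update x j (!x j)) = - cubeSign I v x := by
  unfold cubeSign
  rw [← Finset.mul_prod_erase I _ hj, ← Finset.mul_prod_erase I _ hj, ← neg_mul]
  congr 1
  · cases x j <;> cases v j <;> simp
  · refine Finset.prod_congr rfl fun i hi => ?_
    rw [Function.update_of_ne (Finset.ne_of_mem_erase hi)]

theorem altSum_eq_zero_of_update {I : Finset (Fin n)} {j : Fin n} (hj : j ∈ I)
    (v : Fin n → Bool) {h : (Fin n → Bool) → ℤ}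
    (hh : ∀ x, h (Function.update x j (!x j)) = h x) : altSum I v h = 0 := by
  refine Finset.sum_involution (fun x _ => Function.update x j (!x j)) ?_ ?_ ?_ ?_
  · intro x _
    rw [hh, cubeSign_update hj]
    ring
  · intro x _ _ hx
    have := congrFun hx j
    simp at this
  · intro x hx
    refine mem_cubeAt.2 fun i hi => ?_
    rw [Function.update_of_ne (by rintro rfl; exact hi hj), mem_cubeAt.1 hx i hi]
  · intro x _
    simp

theorem altSum_eq_zero {I : Finset (Fin n)} {v : Fin n → Bool} {h : (Fin n → Bool) → ℤ}
    (hh : ∀ x ∈ cubeAt I v, h x = 0) : altSum I v h = 0 :=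
  Finset.sum_eq_zero fun x hx => by rw [hh x hx, mul_zero]

theorem altSum_agreeInd_of_not_subset {I J : Finset (Fin n)} (h : ¬ J ⊆ I)
    (v u : Fin n → Bool) : altSum J v (agreeInd I u) = 0 := by
  obtain ⟨j, hj, hjI⟩ := Finset.not_subset.1 h
  refine altSum_eq_zero_of_update hj v fun x => Finset.prod_congr rfl fun i hi => ?_
  rw [Function.update_of_ne (by rintro rfl; exact hjI hi)]

theorem altSum_agreeInd_self (I : Finset (Fin n)) (v u : Fin n → Bool) :
    altSum I v (agreeInd I u) = cubeSign I v u := by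
  obtain ⟨x, hx, hxu⟩ := exists_mem_cubeAt_agree I v u
  rw [altSum, Finset.sum_eq_single_of_mem x hx]
  · rw [agreeInd_eq_ite, if_pos hxu, mul_one]
    exact Finset.prod_congr rfl fun i hi => by rw [hxu i hi]
  · intro y hy hyx
    rw [agreeInd_eq_ite, if_neg, mul_zero]
    exact fun hyu => hyx (eq_of_mem_cubeAt hy hx fun i hi => by rw [hyu i hi, hxu i hi])

theorem altSum_single (I : Finset (Fin n)) (v x : Fin n → Bool) :
    altSum I v (Pi.single x 1) = if x ∈ cubeAt I v then cubeSign I v x else 0 := by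
  simp [altSum, Pi.single_apply]

theorem altSum_sub (I : Finset (Fin n)) (v : Fin n → Bool) (g h : (Fin n → Bool) → ℤ) :
    altSum I v (fun x => g x - h x) = altSum I v g - altSum I v h := by
  simp [altSum, mul_sub]

theorem altSum_sum {ι : Type*} (s : Finset ι) (a : ι → ℤ) (I : Finset (Fin n))
    (v : Fin n → Bool) (h : ι → (Fin n → Bool) → ℤ) :
    altSum I v (fun x => ∑ k ∈ s, a k * h k x) = ∑ k ∈ s, a k * altSum I v (h k) := by
  simp only [altSum, Finset.mul_sum]
  rw [Finset.sum_comm]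
  exact Finset.sum_congr rfl fun k _ => Finset.sum_congr rfl fun x _ => by ring

theorem altSum_congr {I : Finset (Fin n)} {v : Fin n → Bool} {g h : (Fin n → Bool) → ℤ}
    (hgh : ∀ x ∈ cubeAt I v, g x = h x) : altSum I v g = altSum I v h :=
  Finset.sum_congr rfl fun x hx => by rw [hgh x hx]

/-- The monomial `∏ i ∈ J, x i`, as an integer-valued function on the cube. -/
abbrev cubeMonomial (J : Finset (Fin n)) : (Fin n → Bool) → ℤ := agreeInd J fun _ => true

/-- Expansion of `agreeInd` into monomials, with leading coefficient `cubeSign`. -/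
theorem agreeInd_eq_sum (J : Finset (Fin n)) (v : Fin n → Bool) :
    ∃ a : Finset (Fin n) → ℤ, a J = cubeSign J (fun _ => true) v ∧
      ∀ x, agreeInd J v x = ∑ t ∈ J.powerset, a t * cubeMonomial t x := by
  refine ⟨fun t => (∏ i ∈ t, if v i = true then 1 else -1) *
    ∏ i ∈ J \ t, if v i = true then 0 else 1, by simp [cubeSign], fun x => ?_⟩
  have : agreeInd J v x = ∏ i ∈ J, ((if v i = true then 1 else -1) *
      (if x i = true then 1 else 0) + if v i = true then 0 else 1) :=
    Finset.prod_congr rfl fun i _ => by cases v i <;> cases x i <;> simp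
  rw [this, Finset.prod_add]
  refine Finset.sum_congr rfl fun t _ => ?_
  rw [Finset.prod_mul_distrib, cubeMonomial, agreeInd]
  ring

/-- The functions which, on `E`, are integer combinations of monomials with colour sets
shattered by `E`. -/
def shatteredSpan (E : Set (Fin n → Bool)) : Submodule ℤ ((Fin n → Bool) → ℤ) where
  carrier := {g | ∃ a : Finset (Fin n) → ℤ, (∀ J, a J ≠ 0 → Shatters E J) ∧
    ∀ x ∈ E, g x = ∑ J, a J * cubeMonomial J x}
  zero_mem' := ⟨0, by simp, by simp⟩
  add_mem' := by
    rintro g h ⟨a, ha, hga⟩ ⟨b, hb, hhb⟩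
    refine ⟨a + b, fun J hJ => ?_, fun x hx => ?_⟩
    · by_cases h0 : a J = 0
      · exact hb J fun h1 => hJ (by simp [h0, h1])
      · exact ha J h0
    · simp [hga x hx, hhb x hx, add_mul, Finset.sum_add_distrib]
  smul_mem' := by
    rintro k g ⟨a, ha, hga⟩
    refine ⟨k • a, fun J hJ => ha J fun h0 => hJ (by simp [h0]), fun x hx => ?_⟩
    simp [hga x hx, Finset.mul_sum, mul_assoc]

theorem mem_shatteredSpan_congr {E : Set (Fin n → Bool)} {g h : (Fin n → Bool) → ℤ}
    (hh : h ∈ shatteredSpan E) (hgh : ∀ x ∈ E, g x = h x) : g ∈ shatteredSpan E := by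
  obtain ⟨a, ha, hha⟩ := hh
  exact ⟨a, ha, fun x hx => by rw [hgh x hx, hha x hx]⟩

theorem cubeMonomial_mem_shatteredSpan (E : Set (Fin n → Bool)) (J : Finset (Fin n)) :
    cubeMonomial J ∈ shatteredSpan E := by
  classical
  induction J using Finset.strongInduction with
  | H J ih =>
    by_cases hJ : Shatters E J
    · refine ⟨Pi.single J 1, fun K hK => ?_, fun x _ => ?_⟩
      · by_cases h : K = J
        · exact h ▸ hJ
        · simp [h] at hK
      · simp [Pi.single_apply]
    · rw [shatters_iff] at hJ
      push Not at hJ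
      obtain ⟨u, hu⟩ := hJ
      obtain ⟨a, haJ, ha⟩ := agreeInd_eq_sum J u
      have hunit : a J * a J = 1 := by
        rw [haJ, cubeSign, ← Finset.prod_mul_distrib]
        exact Finset.prod_eq_one fun i _ => by split_ifs <;> simp
      have hmem : ∑ t ∈ J.ssubsets, (-(a J * a t)) • cubeMonomial t ∈ shatteredSpan E :=
        Submodule.sum_mem _ fun t ht =>
          Submodule.smul_mem _ _ (ih t (Finset.mem_ssubsets.1 ht))
      refine mem_shatteredSpan_congr hmem fun x hx => ?_
      have h0 : agreeInd J u x = 0 := by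
        rw [agreeInd_eq_ite, if_neg]
        intro h
        obtain ⟨i, hi, hne⟩ := hu x hx
        exact hne (h i hi)
      rw [ha, ← Finset.insert_erase (Finset.mem_powerset_self J),
        Finset.sum_insert (Finset.notMem_erase _ _)] at h0
      have hs : J.powerset.erase J = J.ssubsets := rfl
      rw [hs] at h0
      simp only [Finset.sum_apply, Pi.smul_apply, smul_eq_mul, neg_mul, Finset.sum_neg_distrib,
        mul_assoc, ← Finset.mul_sum]
      linear_combination a J * h0 - cubeMonomial J x * hunit

theorem shatteredSpan_eq_top (E : Set (Fin n → Bool)) : shatteredSpan E = ⊤ := by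
  classical
  refine eq_top_iff.2 fun g _ => ?_
  choose a _ ha using agreeInd_eq_sum (n := n) Finset.univ
  have : g = ∑ v, g v • ∑ t ∈ Finset.univ.powerset, a v t • cubeMonomial t := by
    funext x
    simp only [Finset.sum_apply, Pi.smul_apply, smul_eq_mul]
    rw [Finset.sum_eq_single_of_mem x (Finset.mem_univ x), ← ha, agreeInd_eq_ite]
    · simp
    · intro y _ hy
      rw [← ha, agreeInd_eq_ite, if_neg, mul_zero]
      exact fun h => hy (funext fun i => (h i (Finset.mem_univ i)).symm)
  rw [this]
  exact Submodule.sum_mem _ fun v _ => Submodule.smul_mem _ _ <| Submodule.sum_mem _ fun t _ =>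
    Submodule.smul_mem _ _ (cubeMonomial_mem_shatteredSpan E t)

/-- A function whose alternating sum vanishes over one cube in `E` for each colour set
shattered by `E` vanishes on `E`. -/
theorem eq_zero_of_altSum_eq_zero {E : Set (Fin n → Bool)} {g : (Fin n → Bool) → ℤ}
    (h : ∀ J, Shatters E J → ∃ v, (cubeAt J v : Set (Fin n → Bool)) ⊆ E ∧ altSum J v g = 0) :
    ∀ x ∈ E, g x = 0 := by
  classical
  obtain ⟨a, ha, hga⟩ : g ∈ shatteredSpan E := shatteredSpan_eq_top E ▸ Submodule.mem_top
  suffices h0 : ∀ J, a J = 0 by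
    intro x hx
    simp [hga x hx, h0]
  by_contra! hne
  obtain ⟨J, hJ⟩ := Set.Finite.exists_maximal (Set.toFinite {J | a J ≠ 0}) hne
  obtain ⟨v, hvE, hv⟩ := h J (ha J hJ.1)
  rw [altSum_congr fun x hx => hga x (hvE hx), altSum_sum, Finset.sum_eq_single J,
    altSum_agreeInd_self] at hv
  · exact mul_ne_zero hJ.1 (cubeSign_ne_zero _ _ _) hv
  · intro K _ hKJ
    by_cases hK : a K = 0
    · simp [hK]
    · rw [altSum_agreeInd_of_not_subset, mul_zero]
      exact fun hsub => hKJ (le_antisymm (hJ.2 hK hsub) hsub)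
  · simp

/-- A maximal cube of an extremal class is the only cube of its colour set in the class. -/
theorem Extremal.cubeAt_eq_of_maximal {C : Set (Fin n → Bool)} (hC : Extremal C)
    {I : Finset (Fin n)} {v w : Fin n → Bool} (hv : MaximalCubeIn C (cubeAt I v))
    (hw : (cubeAt I w : Set (Fin n → Bool)) ⊆ C) : cubeAt I w = cubeAt I v := by
  classical
  by_contra hne
  set E : Set (Fin n → Bool) := {x | (cubeAt I x : Set (Fin n → Bool)) ⊆ C} with hE
  let g : (Fin n → Bool) → ℤ := fun x => if x ∈ cubeAt I v then 1 else 0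
  have hg : ∀ x ∈ E, g x = 0 := by
    refine eq_zero_of_altSum_eq_zero fun J hJ => ?_
    by_cases hJI : J ⊆ I
    · refine ⟨w, fun x hx => ?_, altSum_eq_zero fun x hx => if_neg fun hxv => hne ?_⟩
      · rwa [hE, Set.mem_ofPred_eq, cubeAt_eq_of_mem (cubeAt_mono hJI w hx)]
      · rw [← cubeAt_eq_of_mem (cubeAt_mono hJI w hx), cubeAt_eq_of_mem hxv]
    · have hIJ : Shatters C (I ∪ J) := by
        refine shatters_iff.2 fun u => ?_
        obtain ⟨x, hx, hxu⟩ := shatters_iff.1 hJ u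
        refine ⟨fun i => if i ∈ I then u i else x i,
          hx (mem_cubeAt.2 fun i hi => if_neg hi), fun i hi => ?_⟩
        by_cases hiI : i ∈ I
        · simp [hiI]
        · simpa [hiI] using hxu i ((Finset.mem_union.1 hi).resolve_left hiI)
      obtain ⟨c, hc, hcC⟩ := hC _ hIJ
      obtain ⟨y, rfl⟩ := hc.exists_eq_cubeAt
      refine ⟨y, fun x hx => ?_, altSum_eq_zero fun x hx => if_neg fun hxv => hJI ?_⟩
      · have hxy := cubeAt_mono (Finset.subset_union_right (s₁ := I)) y hx
        rw [hE, Set.mem_ofPred_eq]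
        refine subset_trans ?_ hcC
        rw [← cubeAt_eq_of_mem hxy]
        exact_mod_cast cubeAt_mono Finset.subset_union_left x
      · have hxy := cubeAt_mono (Finset.subset_union_right (s₁ := I)) y hx
        have hsub : cubeAt I v ⊆ cubeAt (I ∪ J) y := by
          rw [← cubeAt_eq_of_mem hxy, ← cubeAt_eq_of_mem hxv]
          exact cubeAt_mono Finset.subset_union_left x
        have heq := hv.2.2 _ ⟨_, hc⟩ hcC (by exact_mod_cast hsub)
        exact Finset.subset_union_right.trans
          (colours_subset_of_cubeAt_subset (Finset.coe_inj.1 heq).subset)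
  have := hg v hv.2.1
  simp [g, self_mem_cubeAt] at this

section Pair

variable {C D : Set (Fin n → Bool)} {I J : Finset (Fin n)} {v w : Fin n → Bool}

theorem not_shatters_of_maximal (hC : Extremal C) (hD : Extremal D) (hsub : D ⊆ C)
    (hv : MaximalCubeIn C (cubeAt I v)) (hvD : ¬ (cubeAt I v : Set (Fin n → Bool)) ⊆ D) :
    ¬ Shatters D I := by
  intro h
  obtain ⟨c, hc, hcD⟩ := hD I h
  obtain ⟨w, rfl⟩ := hc.exists_eq_cubeAt
  exact hvD (hC.cubeAt_eq_of_maximal hv (hcD.trans hsub) ▸ hcD)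

theorem exists_cubeAt_subset_of_ssubset (hccc : CCC C D)
    (hv : (cubeAt I v : Set (Fin n → Bool)) ⊆ C) (hJ : J ⊂ I) :
    ∃ w, (cubeAt J w : Set (Fin n → Bool)) ⊆ D := by
  have hJv := cubeAt_mono hJ.1 v
  obtain ⟨c, hc, hcD⟩ := hccc J (cubeAt J v) (isCubeOn_cubeAt J v)
    (subset_trans (by exact_mod_cast hJv) hv) fun hmax => by
      have heq := hmax.2.2 _ ⟨_, isCubeOn_cubeAt I v⟩ hv (by exact_mod_cast hJv)
      exact hJ.2 (colours_subset_of_cubeAt_subset (Finset.coe_inj.1 heq).subset)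
  obtain ⟨w, rfl⟩ := hc.exists_eq_cubeAt
  exact ⟨w, hcD⟩

theorem not_ssubset_of_maximal (hC : Extremal C) (hD : Extremal D) (hsub : D ⊆ C)
    (hccc : CCC C D) (hv : (cubeAt I v : Set (Fin n → Bool)) ⊆ C)
    (hw : MaximalCubeIn C (cubeAt J w)) (hwD : ¬ (cubeAt J w : Set (Fin n → Bool)) ⊆ D) :
    ¬ J ⊂ I := fun hJ =>
  let ⟨_, hu⟩ := exists_cubeAt_subset_of_ssubset hccc hv hJ
  not_shatters_of_maximal hC hD hsub hw hwD (shatters_of_cubeAt_subset hu)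

theorem existsUnique_special_vertex (hC : Extremal C) (hD : Extremal D) (hsub : D ⊆ C)
    (hccc : CCC C D) (hv : MaximalCubeIn C (cubeAt I v))
    (hvD : ¬ (cubeAt I v : Set (Fin n → Bool)) ⊆ D) :
    ∃! x, x ∈ cubeAt I v ∧ ∀ y ∈ D, ∃ i ∈ I, y i ≠ x i := by
  have hI := not_shatters_of_maximal hC hD hsub hv hvD
  rw [shatters_iff] at hI
  push Not at hI
  obtain ⟨u, hu⟩ := hI
  obtain ⟨x, hx, hxu⟩ := exists_mem_cubeAt_agree I v u
  have hxD : ∀ y ∈ D, ∃ i ∈ I, y i ≠ x i := fun y hy =>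
    let ⟨i, hi, h⟩ := hu y hy
    ⟨i, hi, by rwa [hxu i hi]⟩
  refine ⟨x, ⟨hx, hxD⟩, fun z ⟨hz, hzD⟩ => eq_of_mem_cubeAt hz hx fun i hi => ?_⟩
  by_contra hne
  obtain ⟨w, hw⟩ := exists_cubeAt_subset_of_ssubset hccc hv.2.1 (Finset.erase_ssubset hi)
  have key : ∀ u : Fin n → Bool, (∀ y ∈ D, ∃ i ∈ I, y i ≠ u i) → w i ≠ u i := by
    intro u hu hwu
    obtain ⟨y, hy, hyu⟩ := exists_mem_cubeAt_agree (I.erase i) w u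
    obtain ⟨j, hj, hyj⟩ := hu y (hw hy)
    by_cases hji : j = i
    · subst hji
      exact hyj ((mem_cubeAt.1 hy j (Finset.notMem_erase j I)).trans hwu)
    · exact hyj (hyu j (Finset.mem_erase.2 ⟨hji, hj⟩))
  have h1 := key x hxD
  have h2 := key z hzD
  revert h1 h2 hne
  cases x i <;> cases z i <;> cases w i <;> simp

/-- Every vertex of `C \ D` is the special vertex of exactly one colour set. -/
theorem existsUnique_colours (hC : Extremal C) (hsub : D ⊆ C) (hD : Extremal D)
    (hccc : CCC C D) {s : Finset (Fin n) → Fin n → Bool}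
    (hs : ∀ I v, MaximalCubeIn C (cubeAt I v) → ¬ (cubeAt I v : Set (Fin n → Bool)) ⊆ D →
      s I ∈ cubeAt I v ∧ ∀ y ∈ D, ∃ i ∈ I, y i ≠ s I i) {x : Fin n → Bool} (hx : x ∈ C \ D) :
    ∃! I, (MaximalCubeIn C (cubeAt I (s I)) ∧ ¬ (cubeAt I (s I) : Set (Fin n → Bool)) ⊆ D) ∧
      s I = x := by
  classical
  let T : Finset (Finset (Fin n)) := {I | MaximalCubeIn C (cubeAt I (s I)) ∧
    ¬ (cubeAt I (s I) : Set (Fin n → Bool)) ⊆ D}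
  have hT : ∀ {I}, I ∈ T ↔ MaximalCubeIn C (cubeAt I (s I)) ∧
    ¬ (cubeAt I (s I) : Set (Fin n → Bool)) ⊆ D := by simp [T]
  let a : Finset (Fin n) → ℤ := fun I => altSum I (s I) (Pi.single x 1)
  have hzero : ∀ y ∈ C, (Pi.single x 1 : (Fin n → Bool) → ℤ) y -
      ∑ I ∈ T, a I * agreeInd I (s I) y = 0 := by
    refine eq_zero_of_altSum_eq_zero fun J hJ => ?_
    by_cases hJD : Shatters D J
    · obtain ⟨c, hc, hcD⟩ := hD J hJD
      obtain ⟨w, rfl⟩ := hc.exists_eq_cubeAt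
      refine ⟨w, hcD.trans hsub, altSum_eq_zero fun y hy => ?_⟩
      have hyx : y ≠ x := fun h => hx.2 (h ▸ hcD hy)
      rw [Pi.single_eq_of_ne hyx, zero_sub, neg_eq_zero]
      refine Finset.sum_eq_zero fun I hI => ?_
      rw [agreeInd_eq_ite, if_neg, mul_zero]
      intro h
      obtain ⟨i, hi, hne⟩ := (hs I _ (hT.1 hI).1 (hT.1 hI).2).2 y (hcD hy)
      exact hne (h i hi)
    · obtain ⟨c, hc, hcC⟩ := hC J hJ
      obtain ⟨w, rfl⟩ := hc.exists_eq_cubeAt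
      have hwD : ¬ (cubeAt J w : Set (Fin n → Bool)) ⊆ D :=
        fun h => hJD (shatters_of_cubeAt_subset h)
      have hmax : MaximalCubeIn C (cubeAt J w) := by
        by_contra h
        obtain ⟨c', hc', hcD'⟩ := hccc J _ hc hcC h
        obtain ⟨w', rfl⟩ := hc'.exists_eq_cubeAt
        exact hJD (shatters_of_cubeAt_subset hcD')
      have hJT : J ∈ T := by
        rw [hT, cubeAt_eq_of_mem (hs J w hmax hwD).1]
        exact ⟨hmax, hwD⟩
      refine ⟨s J, (hT.1 hJT).1.2.1, ?_⟩
      rw [altSum_sub, altSum_sum, Finset.sum_eq_single_of_mem J hJT, altSum_agreeInd_self,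
        cubeSign_of_agree fun _ _ => rfl, mul_one, sub_self]
      intro I hI hIJ
      rw [altSum_agreeInd_of_not_subset, mul_zero]
      exact fun h => not_ssubset_of_maximal hC hD hsub hccc (hT.1 hI).1.2.1 (hT.1 hJT).1
        (hT.1 hJT).2 (h.ssubset_of_ne hIJ.symm)
  have hterm : ∀ I, a I * agreeInd I (s I) x = if s I = x then 1 else 0 := by
    intro I
    simp only [a, altSum_single, agreeInd_eq_ite]
    by_cases h : s I = x
    · subst h
      simp [self_mem_cubeAt, cubeSign_of_agree]
    · rw [if_neg h, mul_ite, mul_zero, ite_eq_right_iff]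
      intro hag
      rw [if_neg, zero_mul]
      exact fun hmem => h (eq_of_mem_cubeAt (self_mem_cubeAt I _) hmem
        fun i hi => (hag i hi).symm)
  have hsum := hzero x hx.1
  simp only [Pi.single_eq_same, hterm, Finset.sum_boole, sub_eq_zero] at hsum
  obtain ⟨I, hI⟩ := Finset.card_eq_one.1 (Nat.cast_eq_one.1 hsum.symm)
  have hmem : ∀ K, K ∈ T ∧ s K = x ↔ K = I := fun K => by
    simpa using Finset.ext_iff.1 hI K
  simp only [hT] at hmem
  exact ⟨I, (hmem I).2 rfl, fun K hK => (hmem K).1 hK⟩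

end Pair

/-- For a proper pair `(C, D)` of extremal classes satisfying the
cubical colour condition, every maximal cube `c` of `C` not contained in `D`, with
colour set `I`, contains a unique vertex whose projection to `I` lies outside
`p_I(D)`, and the assignment of this special vertex gives a bijection from the set
of maximal cubes of `C` not contained in `D` onto `C ∖ D`. -/
theorem special_vertex_bijection (C D : Set (Fin n → Bool))
    (hC : Extremal C) (hD : Extremal D) (hsub : D ⊂ C) (hccc : CCC C D) :
    (∀ (I : Finset (Fin n)) (c : Set (Fin n → Bool)), IsCubeOn I c →
      MaximalCubeIn C c → ¬ c ⊆ D → ∃! v, v ∈ c ∧ proj I v ∉ proj I '' D) ∧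
    ∃ f : Set (Fin n → Bool) → (Fin n → Bool),
      (∀ (I : Finset (Fin n)) (c : Set (Fin n → Bool)), IsCubeOn I c →
        MaximalCubeIn C c → ¬ c ⊆ D → f c ∈ c ∧ proj I (f c) ∉ proj I '' D) ∧
      Set.BijOn f {c | MaximalCubeIn C c ∧ ¬ c ⊆ D} (C \ D) := by
  classical
  have hex : ∀ (I : Finset (Fin n)) (c : Set (Fin n → Bool)), IsCubeOn I c →
      MaximalCubeIn C c → ¬ c ⊆ D → ∃! v, v ∈ c ∧ proj I v ∉ proj I '' D := by
    intro I c hc hmax hcD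
    obtain ⟨v, rfl⟩ := hc.exists_eq_cubeAt
    have := existsUnique_special_vertex hC hD hsub.1 hccc hmax hcD
    simpa [proj_eq_proj_iff] using this
  refine ⟨hex, ?_⟩
  have hcol : ∀ {I J : Finset (Fin n)} {c : Set (Fin n → Bool)}, IsCubeOn I c →
      IsCubeOn J c → I = J := by
    intro I J c hI hJ
    obtain ⟨v, rfl⟩ := hI.exists_eq_cubeAt
    obtain ⟨w, hw⟩ := hJ.exists_eq_cubeAt
    have hw := Finset.coe_inj.1 hw
    exact (colours_subset_of_cubeAt_subset hw.subset).antisymm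
      (colours_subset_of_cubeAt_subset hw.superset)
  have hf : ∀ c : Set (Fin n → Bool), ∃ x, ∀ I, IsCubeOn I c → MaximalCubeIn C c → ¬ c ⊆ D →
      x ∈ c ∧ proj I x ∉ proj I '' D := by
    intro c
    by_cases h : MaximalCubeIn C c ∧ ¬ c ⊆ D
    · obtain ⟨I, hI⟩ := h.1.1
      obtain ⟨x, hx, -⟩ := hex I c hI h.1 h.2
      exact ⟨x, fun J hJ _ _ => hcol hI hJ ▸ hx⟩
    · exact ⟨fun _ => false, fun _ _ h1 h2 => absurd ⟨h1, h2⟩ h⟩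
  choose f hf using hf
  have hs : ∀ I : Finset (Fin n), ∃ x, ∀ v, MaximalCubeIn C (cubeAt I v) →
      ¬ (cubeAt I v : Set (Fin n → Bool)) ⊆ D → x = f (cubeAt I v) := by
    intro I
    by_cases h : ∃ v, MaximalCubeIn C (cubeAt I v) ∧ ¬ (cubeAt I v : Set (Fin n → Bool)) ⊆ D
    · obtain ⟨v, hv, -⟩ := h
      exact ⟨f (cubeAt I v), fun w hw _ => by rw [hC.cubeAt_eq_of_maximal hv hw.2.1]⟩
    · exact ⟨fun _ => false, fun v h1 h2 => absurd ⟨v, h1, h2⟩ h⟩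
  choose s hs using hs
  have hs' : ∀ I v, MaximalCubeIn C (cubeAt I v) → ¬ (cubeAt I v : Set (Fin n → Bool)) ⊆ D →
      s I ∈ cubeAt I v ∧ ∀ y ∈ D, ∃ i ∈ I, y i ≠ s I i := by
    intro I v h1 h2
    have := hf _ I (isCubeOn_cubeAt I v) h1 h2
    rw [← hs I v h1 h2] at this
    simpa [proj_eq_proj_iff] using this
  have hcube : ∀ c, MaximalCubeIn C c → ¬ c ⊆ D → ∃ I, c = cubeAt I (s I) ∧ f c = s I := by
    intro c h1 h2
    obtain ⟨I, hI⟩ := h1.1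
    obtain ⟨v, rfl⟩ := hI.exists_eq_cubeAt
    exact ⟨I, by rw [cubeAt_eq_of_mem (hs' I v h1 h2).1], (hs I v h1 h2).symm⟩
  have hmaps : Set.MapsTo f {c | MaximalCubeIn C c ∧ ¬ c ⊆ D} (C \ D) := by
    rintro c ⟨h1, h2⟩
    obtain ⟨I, hI⟩ := h1.1
    have := hf c I hI h1 h2
    exact ⟨h1.2.1 this.1, fun h => this.2 ⟨_, h, rfl⟩⟩
  refine ⟨f, fun I c hI => hf c I hI, hmaps, ?_, ?_⟩
  · intro c hc c' hc' heq
    have hx := hmaps hc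
    obtain ⟨I, hI, hfI⟩ := hcube c hc.1 hc.2
    obtain ⟨I', hI', hfI'⟩ := hcube c' hc'.1 hc'.2
    have hII : I = I' := (existsUnique_colours hC hsub.1 hD hccc hs' hx).unique
      ⟨hI ▸ hc, hfI.symm⟩ ⟨hI' ▸ hc', (heq.trans hfI').symm⟩
    rw [hI, hI', hII]
  · intro x hx
    obtain ⟨I, ⟨h, hsx⟩, -⟩ := existsUnique_colours hC hsub.1 hD hccc hs' hx
    exact ⟨cubeAt I (s I), h, by rw [← hs I _ h.1 h.2, hsx]⟩
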